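/- arXiv:1607.00802 — 9 statements merged into one kernel-verified Lean document; each statement's English description precedes it below -/
import Mathlib

section
/- Let n = 2k+1 ≥ 3 be an odd integer and let A be the Cartan matrix of type A_n. Let δ ∈ ℤ^n be the vector with δ_i = 1 for i odd and δ_i = 0 for i even. Then {a ∈ ℤ^n : A·a ∈ 2ℤ^n} = 2ℤ^n + ℤ·δ, i.e. it equals the set of all vectors 2b + m·δ with b ∈ ℤ^n and m ∈ ℤ. (Equivalently, for type A_{2k+1}, Q ∩ 2Λ = 2Q + ℤ·α^⋄ where α^⋄ = Σ_{i odd} α_i.) -/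
/-- The Cartan matrix of type `A_n` (0-indexed): `A i i = 2`, `A i j = -1` if `|i-j|=1`,
and `0` otherwise. -/
def cartanA (n : ℕ) : Matrix (Fin n) (Fin n) ℤ :=
  fun i j => if i = j then 2 else if i.val + 1 = j.val ∨ j.val + 1 = i.val then -1 else 0

/-- The vector `δ` with `δ_i = 1` for `i` odd (1-based), i.e. 0-based index even,
and `δ_i = 0` otherwise. -/
def deltaA (n : ℕ) : Fin n → ℤ := fun i => if i.val % 2 = 0 then 1 else 0

/-- The sequence `0, a 0, a 1, …, a (n - 1), 0, 0, …`. -/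
def zeroPad {n : ℕ} (a : Fin n → ℤ) : ℕ → ℤ
  | 0 => 0
  | j + 1 => if h : j < n then a ⟨j, h⟩ else 0

lemma zeroPad_succ {n : ℕ} (a : Fin n → ℤ) (i : Fin n) : zeroPad a (i.val + 1) = a i := by
  simp [zeroPad]

lemma zeroPad_of_lt {n : ℕ} (a : Fin n → ℤ) {j : ℕ} (h : n < j) : zeroPad a j = 0 := by
  obtain _ | j := j
  · rfl
  · exact dif_neg (by omega)

lemma cartanA_mulVec {n : ℕ} (a : Fin n → ℤ) (i : Fin n) :
    (cartanA n).mulVec a i = 2 * a i - zeroPad a i.val - zeroPad a (i.val + 2) := by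
  have hsum : (cartanA n).mulVec a i =
      ∑ j ∈ Finset.range n, ((if j = i.val then 2 * zeroPad a (j + 1) else 0)
        - (if j + 1 = i.val then zeroPad a (j + 1) else 0)
        - (if j = i.val + 1 then zeroPad a (j + 1) else 0)) := by
    rw [Matrix.mulVec, dotProduct, Finset.sum_range]
    refine Finset.sum_congr rfl fun j _ => ?_
    rw [zeroPad_succ]
    simp only [cartanA, Fin.ext_iff]
    split_ifs <;> omega
  have hprev : ∑ j ∈ Finset.range n, (if j + 1 = i.val then zeroPad a (j + 1) else 0)
      = zeroPad a i.val := by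
    obtain ⟨_ | i, hi⟩ := i
    · simp [zeroPad]
    · simp only [Nat.add_right_cancel_iff, Finset.sum_ite_eq', Finset.mem_range]
      exact if_pos (by omega)
  have hnext : ∑ j ∈ Finset.range n, (if j = i.val + 1 then zeroPad a (j + 1) else 0)
      = zeroPad a (i.val + 2) := by
    rw [Finset.sum_ite_eq']
    split_ifs with h
    · rfl
    · rw [zeroPad_of_lt a (by simp at h; omega)]
  rw [hsum, Finset.sum_sub_distrib, Finset.sum_sub_distrib, hprev, hnext, Finset.sum_ite_eq',
    if_pos (by simp), zeroPad_succ]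

lemma two_dvd_cartanA_mulVec_iff {n : ℕ} (a : Fin n → ℤ) (i : Fin n) :
    2 ∣ (cartanA n).mulVec a i ↔ 2 ∣ zeroPad a (i.val + 2) - zeroPad a i.val := by
  rw [cartanA_mulVec]
  omega

/-- For type `A_n` with `n = 2k+1 ≥ 3` odd,
`{a ∈ ℤ^n : A·a ∈ 2ℤ^n} = 2ℤ^n + ℤ·δ`, i.e. `Q ∩ 2Λ = 2Q + ℤ·α⋄`. -/
theorem typeA_odd_QcapTwoLambda (n : ℕ) (hn : 3 ≤ n) (hodd : Odd n) :
    {a : Fin n → ℤ | ∀ i, (2 : ℤ) ∣ (cartanA n).mulVec a i} =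
      {a : Fin n → ℤ | ∃ (b : Fin n → ℤ) (m : ℤ),
        a = fun i => 2 * b i + m * deltaA n i} := by
  ext a
  simp only [Set.mem_ofPred_eq, two_dvd_cartanA_mulVec_iff]
  constructor
  · intro h
    have heven : ∀ j, 2 * j ≤ n + 1 → 2 ∣ zeroPad a (2 * j) := by
      intro j
      induction j with
      | zero => simp [zeroPad]
      | succ j ih =>
        intro hj
        have hstep := h ⟨2 * j, by omega⟩
        have := ih (by omega)
        rw [Nat.mul_succ]
        dsimp only at hstep
        omega
    have hodd_index : ∀ j, 2 * j + 1 ≤ n → 2 ∣ zeroPad a (2 * j + 1) - zeroPad a 1 := by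
      intro j
      induction j with
      | zero => simp
      | succ j ih =>
        intro hj
        have hstep := h ⟨2 * j + 1, by omega⟩
        have := ih (by omega)
        rw [show 2 * (j + 1) + 1 = 2 * j + 1 + 2 by ring]
        dsimp only at hstep
        omega
    refine ⟨fun i => (a i - zeroPad a 1 * deltaA n i) / 2, zeroPad a 1, funext fun i => ?_⟩
    have hdvd : 2 ∣ a i - zeroPad a 1 * deltaA n i := by
      rw [← zeroPad_succ a i, deltaA]
      split_ifs with hi
      · have := hodd_index (i.val / 2) (by omega)
        rwa [show 2 * (i.val / 2) + 1 = i.val + 1 by omega, ← mul_one (zeroPad a 1)] at this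
      · have := heven ((i.val + 1) / 2) (by omega)
        rwa [show 2 * ((i.val + 1) / 2) = i.val + 1 by omega, ← sub_zero (zeroPad a _),
          ← mul_zero (zeroPad a 1)] at this
    rw [Int.mul_ediv_cancel' hdvd]
    ring
  · rintro ⟨b, m, rfl⟩ ⟨i, hi⟩
    obtain ⟨k, rfl⟩ := hodd
    obtain _ | i := i
    · simp only [zeroPad, deltaA]
      split_ifs <;> simp_all
    · simp only [zeroPad, deltaA]
      split_ifs <;> omega
end

section
/- Let n ≥ 5 be an odd integer and let A be the Cartan matrix of type D_n. Then {a ∈ ℤ^n : A·a ∈ 2ℤ^n} = 2ℤ^n + ℤ·(e_{n−1} + e_n), where e_i denotes the i-th standard basis vector of ℤ^n. (Equivalently, for type D_n with n odd, Q ∩ 2Λ = 2Q + ℤ·α^⋄ where α^⋄ = α_{n−1} + α_n.) -/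
/-- The Cartan matrix of type `D_n` (nodes indexed from 0, corresponding to nodes 1,…,n):
`A i i = 2`; `A i j = -1` for the edges `{i, i+1}` (1-based, `1 ≤ i ≤ n-2`) and `{n-2, n}`
(1-based); all other entries `0`. -/
def cartanD (n : ℕ) : Matrix (Fin n) (Fin n) ℤ :=
  fun i j =>
    if i = j then 2
    else if (i.val + 1 = j.val ∧ j.val + 1 < n) ∨ (j.val + 1 = i.val ∧ i.val + 1 < n)
         ∨ (i.val + 3 = n ∧ j.val + 1 = n) ∨ (j.val + 3 = n ∧ i.val + 1 = n) then -1
    else 0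

/-- The vector `e_{n-1} + e_n` (1-based indices), i.e. with entry `1` at the
0-based indices `n-2` and `n-1` and `0` elsewhere. -/
def deltaD (n : ℕ) : Fin n → ℤ := fun i => if i.val + 2 = n ∨ i.val + 1 = n then 1 else 0

/-- Extension of a vector indexed by `Fin n` to all of `ℕ` by zero. -/
def extendZero {n : ℕ} (a : Fin n → ℤ) (k : ℕ) : ℤ := if h : k < n then a ⟨k, h⟩ else 0

theorem extendZero_val {n : ℕ} (a : Fin n → ℤ) (i : Fin n) : extendZero a i.val = a i := by
  simp [extendZero]

theorem sum_ite_eq_and_mul_extendZero {n : ℕ} (a : Fin n → ℤ) (c : ℕ) (P : Prop) [Decidable P]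
    (hc : P → c < n) :
    ∑ j : Fin n, (if j.val = c ∧ P then 1 else 0) * a j = if P then extendZero a c else 0 := by
  by_cases hP : P
  · rw [Finset.sum_eq_single ⟨c, hc hP⟩]
    · simp [hP, extendZero, hc hP]
    · intro j _ hj
      have hne : j.val ≠ c := fun h => hj (Fin.ext h)
      simp [hne]
    · simp
  · simp [hP]

theorem cartanD_apply {n : ℕ} (i j : Fin n) :
    cartanD n i j = 2 * (if j.val = i.val ∧ True then 1 else 0)
      - (if j.val = i.val + 1 ∧ i.val + 2 < n then 1 else 0)
      - (if j.val = i.val - 1 ∧ (1 ≤ i.val ∧ i.val + 1 < n) then 1 else 0)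
      - (if j.val = n - 1 ∧ i.val + 3 = n then 1 else 0)
      - (if j.val = n - 3 ∧ (3 ≤ n ∧ i.val + 1 = n) then 1 else 0) := by
  have := i.isLt
  have := j.isLt
  unfold cartanD
  simp only [Fin.ext_iff, and_true]
  split_ifs <;> omega

theorem cartanD_mulVec {n : ℕ} (a : Fin n → ℤ) (i : Fin n) :
    (cartanD n).mulVec a i = 2 * extendZero a i.val
      - (if i.val + 2 < n then extendZero a (i.val + 1) else 0)
      - (if 1 ≤ i.val ∧ i.val + 1 < n then extendZero a (i.val - 1) else 0)
      - (if i.val + 3 = n then extendZero a (n - 1) else 0)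
      - (if 3 ≤ n ∧ i.val + 1 = n then extendZero a (n - 3) else 0) := by
  have hi := i.isLt
  simp only [Matrix.mulVec, dotProduct, cartanD_apply, sub_mul, mul_assoc,
    Finset.sum_sub_distrib, ← Finset.mul_sum]
  rw [sum_ite_eq_and_mul_extendZero a _ _ (by omega),
    sum_ite_eq_and_mul_extendZero a _ _ (by omega),
    sum_ite_eq_and_mul_extendZero a _ _ (by omega),
    sum_ite_eq_and_mul_extendZero a _ _ (by omega),
    sum_ite_eq_and_mul_extendZero a _ _ (by omega), if_pos trivial]

theorem exists_eq_two_mul_add_deltaD_iff {n : ℕ} (hn : 2 ≤ n) (a : Fin n → ℤ) :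
    (∃ (b : Fin n → ℤ) (m : ℤ), a = fun i => 2 * b i + m * deltaD n i) ↔
      (∀ k, k + 2 < n → 2 ∣ extendZero a k) ∧
        2 ∣ extendZero a (n - 2) + extendZero a (n - 1) := by
  constructor
  · rintro ⟨b, m, rfl⟩
    refine ⟨fun k hk => ?_, ?_⟩
    · have h₁ : k < n := by omega
      have h₂ : ¬(k + 2 = n ∨ k + 1 = n) := by omega
      simp [extendZero, deltaD, h₁, h₂]
    · have h₁ : n - 2 < n := by omega
      have h₂ : n - 1 < n := by omega
      have h₃ : n - 2 + 2 = n := by omega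
      have h₄ : n - 1 + 1 = n := by omega
      simp only [extendZero, deltaD, h₁, h₂, h₃, h₄, dite_true, true_or, or_true, if_true]
      omega
  · rintro ⟨h, hlast⟩
    refine ⟨fun i => (a i - extendZero a (n - 1) * deltaD n i) / 2, extendZero a (n - 1), ?_⟩
    funext i
    have hdvd : 2 ∣ a i - extendZero a (n - 1) * deltaD n i := by
      have hi := i.isLt
      have hlow := h i.val
      rw [← extendZero_val a i]
      unfold deltaD
      rcases (by omega : i.val + 2 < n ∨ i.val = n - 2 ∨ i.val = n - 1) with hk | hk | hk
      · rw [if_neg (by omega)]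
        simpa using hlow hk
      · rw [if_pos (by omega), hk]
        omega
      · rw [if_pos (by omega), hk]
        omega
    rw [Int.mul_ediv_cancel' hdvd]
    ring

/-- For type `D_n` with `n ≥ 5` odd,
`{a ∈ ℤ^n : A·a ∈ 2ℤ^n} = 2ℤ^n + ℤ·(e_{n-1} + e_n)`, i.e. `Q ∩ 2Λ = 2Q + ℤ·α⋄`. -/
theorem typeD_odd_QcapTwoLambda (n : ℕ) (hn : 5 ≤ n) (hodd : Odd n) :
    {a : Fin n → ℤ | ∀ i, (2 : ℤ) ∣ (cartanD n).mulVec a i} =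
      {a : Fin n → ℤ | ∃ (b : Fin n → ℤ) (m : ℤ),
        a = fun i => 2 * b i + m * deltaD n i} := by
  ext a
  rw [Set.mem_ofPred_eq, Set.mem_ofPred_eq, exists_eq_two_mul_add_deltaD_iff (by omega)]
  simp only [cartanD_mulVec]
  constructor
  · intro h
    have row (k : ℕ) (hk : k < n) := h ⟨k, hk⟩
    simp only at row
    have hone : 2 ∣ extendZero a 1 := by
      have := row 0 (by omega)
      split_ifs at this <;> first | omega | (norm_num at this; omega)
    have hthird : 2 ∣ extendZero a (n - 3) := by
      have := row (n - 1) (by omega)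
      split_ifs at this <;> omega
    have hstep (k : ℕ) (hk : k + 4 < n) :
        2 ∣ extendZero a k + extendZero a (k + 2) := by
      have := row (k + 1) (by omega)
      rw [if_pos (by omega), if_pos (by omega), if_neg (by omega), if_neg (by omega),
        Nat.add_sub_cancel, add_assoc k 1 1] at this
      norm_num at this
      omega
    have hoddIndex (j : ℕ) (hj : 2 * j + 1 + 2 < n) : 2 ∣ extendZero a (2 * j + 1) := by
      induction j with
      | zero => exact hone
      | succ j ih =>
        have h₁ := ih (by omega)
        have h₂ := hstep (2 * j + 1) (by omega)
        rw [show 2 * (j + 1) + 1 = 2 * j + 1 + 2 by ring]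
        omega
    have hevenIndex (j : ℕ) (hj : 2 * j + 3 ≤ n) : 2 ∣ extendZero a (n - 3 - 2 * j) := by
      induction j with
      | zero => exact hthird
      | succ j ih =>
        have h₁ := ih (by omega)
        have h₂ := hstep (n - 3 - 2 * (j + 1)) (by omega)
        rw [show n - 3 - 2 * (j + 1) + 2 = n - 3 - 2 * j by omega] at h₂
        omega
    have hlow (k : ℕ) (hk : k + 2 < n) : 2 ∣ extendZero a k := by
      obtain ⟨r, hr⟩ := hodd
      rcases Nat.even_or_odd' k with ⟨j, rfl | rfl⟩
      · have := hevenIndex (r - 1 - j) (by omega)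
        rwa [show n - 3 - 2 * (r - 1 - j) = 2 * j by omega] at this
      · exact hoddIndex j hk
    refine ⟨hlow, ?_⟩
    have h₁ := row (n - 3) (by omega)
    have h₂ := hlow (n - 4) (by omega)
    rw [if_pos (by omega), if_pos (by omega), if_pos (by omega), if_neg (by omega),
      show n - 3 + 1 = n - 2 by omega, show n - 3 - 1 = n - 4 by omega] at h₁
    omega
  · rintro ⟨hlow, hlast⟩ i
    have hi := i.isLt
    have hnext := hlow (i.val + 1)
    have hprev := hlow (i.val - 1)
    have hthird := hlow (n - 3) (by omega)
    by_cases hbranch : i.val + 3 = n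
    · rw [if_pos (by omega), if_pos (by omega), if_pos (by omega), if_neg (by omega),
        show i.val + 1 = n - 2 by omega]
      omega
    · split_ifs <;> omega
end

section
/- Let n ≥ 5 be an odd integer, let A be the Cartan matrix of type D_n, and let v = 2(e_{n−1} + e_n − e_{n−2}) ∈ ℤ^n, where e_i is the i-th standard basis vector. Then the subgroup of ℤ^n generated by {2·A·e_j : 1 ≤ j ≤ n} ∪ {v} equals the subgroup of ℤ^n generated by {2e_i : 1 ≤ i ≤ n−2} ∪ {4e_{n−1}, 4e_n, v}. (Equivalently, in fundamental-weight coordinates for type D_n with n odd, 2Q + ℤα^⋄ = 4ℤλ_{n−1} + 4ℤλ_n + ℤα^⋄ + Σ_{i=1}^{n−2} 2ℤλ_i, where α^⋄ = α_{n−1} + α_n.) -/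
/-- The vector `v = 2(e_{n-1} + e_n - e_{n-2})` (1-based indices): entries `2` at the
0-based indices `n-2` and `n-1`, entry `-2` at the 0-based index `n-3`, and `0` elsewhere. -/
def vD (n : ℕ) : Fin n → ℤ :=
  fun i => if i.val + 2 = n ∨ i.val + 1 = n then 2 else if i.val + 3 = n then -2 else 0

/-- The standard basis vector with entry `1` at `k`, extended by `0` to all `k : ℕ`. -/
def unitVec (n k : ℕ) : Fin n → ℤ := fun i => if i.val = k then 1 else 0

lemma single_eq_unitVec {n : ℕ} (i : Fin n) : (Pi.single i 1 : Fin n → ℤ) = unitVec n i := by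
  funext j
  simp [unitVec, Pi.single_apply, Fin.ext_iff]

lemma vD_eq (m : ℕ) :
    vD (m + 3) = (2 : ℤ) • (unitVec (m + 3) (m + 1) + unitVec (m + 3) (m + 2)
      - unitVec (m + 3) m) := by
  funext i
  simp only [vD, unitVec, Pi.smul_apply, Pi.add_apply, Pi.sub_apply, smul_eq_mul]
  split_ifs <;> omega

lemma cartanD_col_zero (m : ℕ) (hm : 1 ≤ m) :
    (cartanD (m + 3)).col ⟨0, by omega⟩ = (2 : ℤ) • unitVec (m + 3) 0 - unitVec (m + 3) 1 := by
  funext i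
  simp only [Matrix.col_apply, cartanD, unitVec, Pi.smul_apply, Pi.sub_apply, smul_eq_mul,
    Fin.ext_iff]
  split_ifs <;> grind

lemma cartanD_col_succ (m k : ℕ) (hk : k + 1 < m) :
    (cartanD (m + 3)).col ⟨k + 1, by omega⟩ = (2 : ℤ) • unitVec (m + 3) (k + 1)
      - unitVec (m + 3) k - unitVec (m + 3) (k + 2) := by
  funext i
  simp only [Matrix.col_apply, cartanD, unitVec, Pi.smul_apply, Pi.sub_apply, smul_eq_mul,
    Fin.ext_iff]
  split_ifs <;> omega

lemma cartanD_col_branch (k : ℕ) :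
    (cartanD (k + 1 + 3)).col ⟨k + 1, by omega⟩ = (2 : ℤ) • unitVec (k + 1 + 3) (k + 1)
      - unitVec (k + 1 + 3) k - unitVec (k + 1 + 3) (k + 2) - unitVec (k + 1 + 3) (k + 3) := by
  funext i
  simp only [Matrix.col_apply, cartanD, unitVec, Pi.smul_apply, Pi.sub_apply, smul_eq_mul,
    Fin.ext_iff, true_and]
  split_ifs <;> omega

lemma cartanD_col_leaf (m k : ℕ) (hk : k = m + 1 ∨ k = m + 2) :
    (cartanD (m + 3)).col ⟨k, by omega⟩ = (2 : ℤ) • unitVec (m + 3) k - unitVec (m + 3) m := by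
  funext i
  simp only [Matrix.col_apply, cartanD, unitVec, Pi.smul_apply, Pi.sub_apply, smul_eq_mul,
    Fin.ext_iff]
  split_ifs <;> omega

/-- A subgroup containing `v` and the doubled columns of the Cartan matrix contains
`2 e_i` for every node `i` on the long arm, the branch node included. -/
lemma two_smul_unitVec_mem {m : ℕ} (hm : 1 ≤ m) {L : AddSubgroup (Fin (m + 3) → ℤ)}
    (hcol : ∀ j, (2 : ℤ) • (cartanD (m + 3)).col j ∈ L) (hv : vD (m + 3) ∈ L)
    {k : ℕ} (hk : k ≤ m) : (2 : ℤ) • unitVec (m + 3) k ∈ L := by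
  have hdiff : ∀ t k, k + 1 + t = m →
      (2 : ℤ) • unitVec (m + 3) (k + 1) - (2 : ℤ) • unitVec (m + 3) k ∈ L := by
    intro t
    induction t with
    | zero =>
      rintro k rfl
      have h := L.add_mem (hcol ⟨k + 1, by omega⟩) hv
      rw [vD_eq, cartanD_col_branch] at h
      convert h using 1
      module
    | succ t ih =>
      intro k hk
      have h := L.add_mem (hcol ⟨k + 1, by omega⟩) (ih (k + 1) (by omega))
      rw [cartanD_col_succ m k (by omega)] at h
      convert h using 1
      module
  induction k with
  | zero =>
    have h := L.add_mem (hcol ⟨0, by omega⟩) (hdiff (m - 1) 0 (by omega))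
    rw [cartanD_col_zero m hm] at h
    convert h using 1
    module
  | succ k ih =>
    simpa using L.add_mem (hdiff (m - (k + 1)) k (by omega)) (ih (by omega))

/-- A subgroup containing `v`, `2 e_i` for the nodes `i` on the long arm and `4 e_i` for the two
leaves at the fork contains the doubled columns of the Cartan matrix. -/
lemma two_smul_cartanD_col_mem {m : ℕ} (hm : 1 ≤ m) {R : AddSubgroup (Fin (m + 3) → ℤ)}
    (harm : ∀ k ≤ m, (2 : ℤ) • unitVec (m + 3) k ∈ R)
    (hleaf : ∀ k, k = m + 1 ∨ k = m + 2 → (4 : ℤ) • unitVec (m + 3) k ∈ R)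
    (hv : vD (m + 3) ∈ R) (j : Fin (m + 3)) : (2 : ℤ) • (cartanD (m + 3)).col j ∈ R := by
  obtain ⟨j, hj⟩ := j
  by_cases hjl : j = m + 1 ∨ j = m + 2
  · rw [cartanD_col_leaf m j hjl]
    convert R.sub_mem (hleaf j hjl) (harm m le_rfl) using 1
    module
  obtain _ | k := j
  · rw [cartanD_col_zero m hm]
    convert R.sub_mem (R.zsmul_mem (harm 0 (by omega)) 2) (harm 1 hm) using 1
    module
  obtain hk | rfl : k + 1 < m ∨ m = k + 1 := by omega
  · rw [cartanD_col_succ m k hk]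
    convert R.sub_mem (R.sub_mem (R.zsmul_mem (harm (k + 1) (by omega)) 2)
      (harm k (by omega))) (harm (k + 2) (by omega)) using 1
    module
  · rw [cartanD_col_branch]
    rw [vD_eq] at hv
    convert R.sub_mem (R.sub_mem (harm (k + 1) le_rfl) (harm k (by omega))) hv using 1
    module

/-- For type `D_n` with `n ≥ 5` odd: the subgroup of `ℤ^n` generated by the doubled columns
`2·A·e_j` of the Cartan matrix together with `v = 2(e_{n-1}+e_n-e_{n-2})` equals the subgroup
generated by `2e_i (1 ≤ i ≤ n-2)`, `4e_{n-1}`, `4e_n` and `v`; i.e. in fundamental-weight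
coordinates `2Q + ℤα⋄ = 4ℤλ_{n-1} + 4ℤλ_n + ℤα⋄ + Σ_{i=1}^{n-2} 2ℤλ_i`. -/
theorem typeD_odd_twoQ_plus_diamond (n : ℕ) (hn : 5 ≤ n) (hodd : Odd n) :
    AddSubgroup.closure
        ((Set.range fun j : Fin n => (2 : ℤ) • (cartanD n).mulVec (Pi.single j 1)) ∪ {vD n}) =
      AddSubgroup.closure
        ({x : Fin n → ℤ | ∃ i : Fin n, i.val + 2 < n ∧ x = (2 : ℤ) • Pi.single i 1} ∪
         {x : Fin n → ℤ | ∃ i : Fin n, (i.val + 2 = n ∨ i.val + 1 = n) ∧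
            x = (4 : ℤ) • Pi.single i 1} ∪
         {vD n}) := by
  obtain ⟨m, rfl⟩ : ∃ m, n = m + 3 := ⟨n - 3, by omega⟩
  have hm : 1 ≤ m := by omega
  simp only [Matrix.mulVec_single_one]
  simp only [single_eq_unitVec]
  apply le_antisymm
  · rw [AddSubgroup.closure_le]
    rintro x (⟨j, rfl⟩ | rfl)
    · refine two_smul_cartanD_col_mem hm (fun k hk => ?_) (fun k hk => ?_) ?_ j
      · exact AddSubgroup.subset_closure
          (Or.inl (Or.inl ⟨⟨k, by omega⟩, by simp only; omega, rfl⟩))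
      · exact AddSubgroup.subset_closure
          (Or.inl (Or.inr ⟨⟨k, by omega⟩, by simp only; omega, rfl⟩))
      · exact AddSubgroup.subset_closure (Or.inr rfl)
    · exact AddSubgroup.subset_closure (Or.inr rfl)
  · rw [AddSubgroup.closure_le]
    set L := AddSubgroup.closure
      ((Set.range fun j => (2 : ℤ) • (cartanD (m + 3)).col j) ∪ {vD (m + 3)})
    have hcol : ∀ j, (2 : ℤ) • (cartanD (m + 3)).col j ∈ L := fun j =>
      AddSubgroup.subset_closure (Or.inl ⟨j, rfl⟩)
    have hv : vD (m + 3) ∈ L := AddSubgroup.subset_closure (Or.inr rfl)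
    rintro x ((⟨i, hi, rfl⟩ | ⟨i, hi, rfl⟩) | rfl)
    · exact two_smul_unitVec_mem hm hcol hv (by omega)
    · have h := L.add_mem (hcol i) (two_smul_unitVec_mem hm hcol hv le_rfl)
      rw [cartanD_col_leaf m i (by omega)] at h
      rw [SetLike.mem_coe]
      convert h using 1
      module
    · exact hv
end

section
/- Let n ≥ 1 and let L be a subgroup of ℤ^n. Let M = L ∩ ℕ^n, a submonoid of (ℕ^n, +). Then the set of irreducible elements of M, i.e. {t ∈ M : t ≠ 0 and there exist no nonzero u, v ∈ M with t = u + v}, is finite. -/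
/-- An element `t` of a submonoid `M` of `ℕ^n` is irreducible (minimal) if `t ≠ 0`
and `t` is not the sum of two nonzero elements of `M`. -/
def IsIrredIn {n : ℕ} (M : Set (Fin n → ℕ)) (t : Fin n → ℕ) : Prop :=
  t ∈ M ∧ t ≠ 0 ∧ ¬ ∃ u v : Fin n → ℕ, u ∈ M ∧ v ∈ M ∧ u ≠ 0 ∧ v ≠ 0 ∧ t = u + v

/-- For any subgroup `L` of `ℤ^n` (`n ≥ 1`), the set of irreducible elements of
the submonoid `M = L ∩ ℕ^n` of `ℕ^n` is finite. -/
theorem irreducibles_of_lattice_monoid_finite (n : ℕ) (hn : 1 ≤ n)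
    (L : AddSubgroup (Fin n → ℤ)) :
    {t : Fin n → ℕ |
      IsIrredIn {s : Fin n → ℕ | (fun i => (s i : ℤ)) ∈ L} t}.Finite := by
  refine IsAntichain.finite_of_wellQuasiOrdered (r := (· ≤ ·)) ?_ wellQuasiOrdered_le
  rintro s ⟨hsL, hs0, -⟩ t ⟨htL, -, hirr⟩ hne hle
  refine hirr ⟨s, t - s, hsL, ?_, hs0, ?_, (add_tsub_cancel_of_le hle).symm⟩
  · have hsub : (fun i => ((t - s) i : ℤ)) = (fun i => (t i : ℤ)) - fun i => (s i : ℤ) := by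
      ext i
      simp [Nat.cast_sub (hle i)]
    simpa only [Set.mem_ofPred_eq, hsub] using L.sub_mem htL hsL
  · exact fun h => hne (le_antisymm hle (tsub_eq_zero_iff_le.mp h))
end

section
/- Let M = {t ∈ ℕ^6 : 3 divides t_1 + 2t_3 + t_5 + 2t_6}, a submonoid of (ℕ^6, +). Then the set of irreducible elements of M is exactly the 14-element set {3e_1, e_2, 3e_3, e_4, 3e_5, 3e_6, e_1+e_3, e_1+e_6, e_3+e_5, e_5+e_6, e_1+2e_5, 2e_1+e_5, e_3+2e_6, 2e_3+e_6}, where e_i denotes the i-th standard basis vector of ℕ^6. (This monoid is the monoid Ψ of dominant weights lying in the root lattice for type E_6, written in fundamental-weight coordinates, and the 14 elements form Ψ_min.) -/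
/-- The `i`-th standard basis vector of `ℕ^n`. -/
def eN {n : ℕ} (i : Fin n) : Fin n → ℕ := Pi.single i 1

/-- The monoid `Ψ` of type `E_6` in fundamental-weight coordinates (0-indexed):
`M = {t ∈ ℕ^6 : 3 ∣ t_1 + 2t_3 + t_5 + 2t_6}`. -/
def psiE6 : Set (Fin 6 → ℕ) := {t | 3 ∣ t 0 + 2 * t 2 + t 4 + 2 * t 5}

lemma mem_psiE6_iff (t : Fin 6 → ℕ) : t ∈ psiE6 ↔ 3 ∣ t 0 + 2 * t 2 + t 4 + 2 * t 5 := Iff.rfl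

lemma sum_ne_one_of_three_dvd {a b c d : ℕ} (h : 3 ∣ a + 2 * b + c + 2 * d) :
    a + b + c + d ≠ 1 := by
  omega

lemma ne_zero_iff_sum_pos (t : Fin 6 → ℕ) :
    t ≠ 0 ↔ 0 < t 0 + t 1 + t 2 + t 3 + t 4 + t 5 := by
  rw [← Fin.sum_univ_six, Finset.sum_pos_iff, Function.ne_iff]
  simp [Nat.pos_iff_ne_zero]

lemma le_iff_fin_six (s t : Fin 6 → ℕ) :
    s ≤ t ↔ s 0 ≤ t 0 ∧ s 1 ≤ t 1 ∧ s 2 ≤ t 2 ∧ s 3 ≤ t 3 ∧ s 4 ≤ t 4 ∧ s 5 ≤ t 5 := by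
  simp [Pi.le_def, Fin.forall_fin_succ]

/-- An irreducible element of `psiE6` equals every nonzero element of `psiE6` below it. -/
lemma IsIrredIn.eq_of_le {t g : Fin 6 → ℕ} (h : IsIrredIn psiE6 t) (hg : g ∈ psiE6)
    (hg0 : g ≠ 0) (hle : g ≤ t) : t = g := by
  by_contra hne
  have hsum : t = g + (t - g) := (add_tsub_cancel_of_le hle).symm
  refine h.2.2 ⟨g, t - g, hg, ?_, hg0, fun h0 => hne ?_, hsum⟩
  · have ht := h.1
    rw [mem_psiE6_iff] at *
    rw [le_iff_fin_six] at hle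
    simp only [Pi.sub_apply]
    omega
  · rwa [h0, add_zero] at hsum

/-- The set of irreducible elements of `psiE6` is exactly the 14-element set
`{3λ₁, λ₂, 3λ₃, λ₄, 3λ₅, 3λ₆, λ₁+λ₃, λ₁+λ₆, λ₃+λ₅, λ₅+λ₆, λ₁+2λ₅, 2λ₁+λ₅, λ₃+2λ₆, 2λ₃+λ₆}`
(in 0-indexed coordinates), i.e. `Ψ_min` for type `E_6`. -/
theorem psiE6_min :
    {t : Fin 6 → ℕ | IsIrredIn psiE6 t} =
      ({3 • eN 0, eN 1, 3 • eN 2, eN 3, 3 • eN 4, 3 • eN 5,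
        eN 0 + eN 2, eN 0 + eN 5, eN 2 + eN 4, eN 4 + eN 5,
        eN 0 + 2 • eN 4, 2 • eN 0 + eN 4, eN 2 + 2 • eN 5, 2 • eN 2 + eN 5} :
        Set (Fin 6 → ℕ)) := by
  ext t
  simp only [Set.mem_ofPred_eq, Set.mem_insert_iff, Set.mem_singleton_iff]
  constructor
  · intro h
    by_contra! hne
    obtain ⟨n1, n2, n3, n4, n5, n6, n7, n8, n9, n10, n11, n12, n13, n14⟩ := hne
    have key : ∀ g, t ≠ g → g ∈ psiE6 → g ≠ 0 → ¬ g ≤ t :=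
      fun g hne hg hg0 hle => hne (h.eq_of_le hg hg0 hle)
    have hpos := (ne_zero_iff_sum_pos t).1 h.2.1
    have hmem := h.1
    simp only [mem_psiE6_iff, ne_zero_iff_sum_pos, le_iff_fin_six] at key hmem
    replace n1 := key _ n1
    replace n2 := key _ n2
    replace n3 := key _ n3
    replace n4 := key _ n4
    replace n5 := key _ n5
    replace n6 := key _ n6
    replace n7 := key _ n7
    replace n8 := key _ n8
    replace n9 := key _ n9
    replace n10 := key _ n10
    replace n11 := key _ n11
    replace n12 := key _ n12
    replace n13 := key _ n13
    replace n14 := key _ n14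
    simp [eN] at n1 n2 n3 n4 n5 n6 n7 n8 n9 n10 n11 n12 n13 n14
    clear key
    omega
  · simp only [IsIrredIn, mem_psiE6_iff, ne_zero_iff_sum_pos, not_exists]
    rintro (rfl | rfl | rfl | rfl | rfl | rfl | rfl | rfl | rfl | rfl | rfl | rfl | rfl | rfl) <;>
    · refine ⟨by simp [eN], by simp [eN], ?_⟩
      rintro u v ⟨hu, hv, hu0, hv0, h⟩
      have h0 := congrFun h 0
      have h1 := congrFun h 1
      have h2 := congrFun h 2
      have h3 := congrFun h 3
      have h4 := congrFun h 4
      have h5 := congrFun h 5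
      simp [eN] at h0 h1 h2 h3 h4 h5
      have hu1 := sum_ne_one_of_three_dvd hu
      have hv1 := sum_ne_one_of_three_dvd hv
      omega
end

section
/- Let n ≥ 2, let r = (n+1)/gcd(n+1, 2), and let M_r = {t ∈ ℕ^n : r divides Σ_{i=1}^n i·t_i}. For 1 ≤ k ≤ n put r_k = r/gcd(r, k). Then every element of the set {r_k·e_k : 1 ≤ k ≤ n} ∪ {e_1 + e_n} is an irreducible element of M_r, these elements are pairwise distinct, and hence M_r has at least n+1 irreducible elements. (For type A_n with n ≥ 2, this shows |Ψ_min| ≥ n+1, so the center of U_q(sl_{n+1}) is not a polynomial algebra.) -/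
/-- `r = (n+1)/gcd(n+1, 2)`. -/
def rA (n : ℕ) : ℕ := (n + 1) / Nat.gcd (n + 1) 2

/-- The monoid `M_r = Ψ` of type `A_n` in fundamental-weight coordinates:
`{t ∈ ℕ^n : r ∣ Σ i·t_i}` (1-based indices `i`). -/
def MrA (n : ℕ) : Set (Fin n → ℕ) := {t | rA n ∣ ∑ i, (i.val + 1) * t i}

theorem rA_dvd (n : ℕ) : rA n ∣ n + 1 :=
  Nat.div_dvd_of_dvd (Nat.gcd_dvd_left _ _)

theorem two_le_rA {n : ℕ} (hn : 2 ≤ n) : 2 ≤ rA n := by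
  rcases (Nat.dvd_prime Nat.prime_two).1 (Nat.gcd_dvd_right (n + 1) 2) with h | h
  · rw [rA, h]; omega
  · have h2 : 2 ∣ n + 1 := h ▸ Nat.gcd_dvd_left (n + 1) 2
    rw [rA, h]; omega

theorem Nat.dvd_mul_iff_div_gcd_dvd {r : ℕ} (hr : 0 < r) (k c : ℕ) :
    r ∣ k * c ↔ r / Nat.gcd r k ∣ c := by
  have hg : 0 < Nat.gcd r k := Nat.gcd_pos_of_pos_left k hr
  rw [← (Nat.coprime_div_gcd_div_gcd hg).dvd_mul_left, ← Nat.mul_dvd_mul_iff_left (b := _ / _) hg,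
    Nat.mul_div_cancel' (Nat.gcd_dvd_left r k), ← mul_assoc,
    Nat.mul_div_cancel' (Nat.gcd_dvd_right r k)]

theorem smul_eN_apply_self {n : ℕ} (c : ℕ) (i : Fin n) : (c • eN i) i = c := by
  simp [eN]

theorem smul_eN_apply_of_ne {n : ℕ} (c : ℕ) {i j : Fin n} (h : j ≠ i) : (c • eN i) j = 0 := by
  simp [eN, h]

theorem eq_smul_eN {n : ℕ} {u : Fin n → ℕ} {i : Fin n} (h : ∀ j, j ≠ i → u j = 0) :
    u = u i • eN i := by
  funext j
  by_cases hj : j = i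
  · subst hj; rw [smul_eN_apply_self]
  · rw [h j hj, smul_eN_apply_of_ne _ hj]

theorem smul_eN_mem_MrA {n : ℕ} (hr : 0 < rA n) (c : ℕ) (i : Fin n) :
    c • eN i ∈ MrA n ↔ rA n / Nat.gcd (rA n) (i.val + 1) ∣ c := by
  rw [← Nat.dvd_mul_iff_div_gcd_dvd hr]
  have h : ∑ j : Fin n, (j.val + 1) * (c • eN i) j = (i.val + 1) * c := by
    rw [Finset.sum_eq_single i, smul_eN_apply_self]
    · intro j _ hj
      rw [smul_eN_apply_of_ne _ hj, mul_zero]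
    · simp
  rw [MrA, Set.mem_ofPred_eq, h]

theorem isIrredIn_smul_eN {n : ℕ} (hr : 0 < rA n) (i : Fin n) :
    IsIrredIn (MrA n) ((rA n / Nat.gcd (rA n) (i.val + 1)) • eN i) := by
  have hpos : 0 < rA n / Nat.gcd (rA n) (i.val + 1) := Nat.div_gcd_pos_of_pos_left _ hr
  refine ⟨(smul_eN_mem_MrA hr _ i).2 dvd_rfl, fun h => ?_, ?_⟩
  · have := congrFun h i
    rw [smul_eN_apply_self] at this
    exact hpos.ne' this
  · rintro ⟨u, v, hu, hv, hu0, hv0, huv⟩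
    have hzero : ∀ j, j ≠ i → u j = 0 ∧ v j = 0 := by
      intro j hj
      have := congrFun huv j
      rw [smul_eN_apply_of_ne _ hj, Pi.add_apply] at this
      omega
    have hi := congrFun huv i
    rw [smul_eN_apply_self, Pi.add_apply] at hi
    have hle : ∀ w : Fin n → ℕ, w ∈ MrA n → w ≠ 0 → (∀ j, j ≠ i → w j = 0) →
        rA n / Nat.gcd (rA n) (i.val + 1) ≤ w i := by
      intro w hw hw0 hwz
      have hwe := eq_smul_eN hwz
      rw [hwe, smul_eN_mem_MrA hr] at hw
      refine Nat.le_of_dvd (Nat.pos_of_ne_zero fun h => hw0 ?_) hw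
      rw [hwe, h, zero_smul]
    have h1 := hle u hu hu0 fun j hj => (hzero j hj).1
    have h2 := hle v hv hv0 fun j hj => (hzero j hj).2
    omega

theorem eN_zero_notMem_MrA {n : ℕ} (hr : 2 ≤ rA n) (h0 : 0 < n) :
    eN ⟨0, h0⟩ ∉ MrA n := by
  rw [← one_smul ℕ (eN (⟨0, h0⟩ : Fin n)), smul_eN_mem_MrA (by omega), Nat.dvd_one]
  simp
  omega

theorem eN_zero_add_eN_last_mem_MrA {n : ℕ} (h0 : 0 < n) (hl : n - 1 < n) :
    eN ⟨0, h0⟩ + eN ⟨n - 1, hl⟩ ∈ MrA n := by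
  have h : ∑ j : Fin n, (j.val + 1) * (eN ⟨0, h0⟩ + eN ⟨n - 1, hl⟩ : Fin n → ℕ) j = n + 1 := by
    simp [eN, mul_add, Finset.sum_add_distrib, Pi.single_apply]
    omega
  rw [MrA, Set.mem_ofPred_eq, h]
  exact rA_dvd n

theorem isIrredIn_eN_zero_add_eN_last {n : ℕ} (hn : 2 ≤ n) (h0 : 0 < n) (hl : n - 1 < n) :
    IsIrredIn (MrA n) (eN ⟨0, h0⟩ + eN ⟨n - 1, hl⟩) := by
  have hne : (⟨0, h0⟩ : Fin n) ≠ ⟨n - 1, hl⟩ := by simp; omega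
  have hnot := eN_zero_notMem_MrA (two_le_rA hn) h0
  refine ⟨eN_zero_add_eN_last_mem_MrA h0 hl, fun h => ?_, ?_⟩
  · have := congrFun h ⟨0, h0⟩
    simp [eN] at this
  · rintro ⟨u, v, hu, hv, hu0, hv0, huv⟩
    generalize (⟨0, h0⟩ : Fin n) = a at *
    generalize (⟨n - 1, hl⟩ : Fin n) = b at *
    have ha : 1 = u a + v a := by simpa [eN, hne] using congrFun huv a
    have hb : 1 = u b + v b := by simpa [eN, hne.symm] using congrFun huv b
    have hz : ∀ j, j ≠ a → j ≠ b → 0 = u j + v j := by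
      intro j hja hjb
      simpa [eN, hja, hjb] using congrFun huv j
    have hzero : ∀ w : Fin n → ℕ, w ≠ 0 → (∀ j, j ≠ a → j ≠ b → w j = 0) → w a = 0 →
        w b ≠ 0 := by
      intro w hw hwz hwa hwb
      refine hw (funext fun j => ?_)
      by_cases hja : j = a
      · rw [hja, hwa]; rfl
      by_cases hjb : j = b
      · rw [hjb, hwb]; rfl
      exact hwz j hja hjb
    have hone : ∀ w : Fin n → ℕ, w ∈ MrA n → (∀ j, j ≠ a → j ≠ b → w j = 0) → w a = 1 →
        w b ≠ 0 := by
      intro w hw hwz hwa hwb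
      apply hnot
      have : w = w a • eN a := eq_smul_eN fun j hja => by
        by_cases hjb : j = b
        · rw [hjb, hwb]
        · exact hwz j hja hjb
      rwa [this, hwa, one_smul] at hw
    have huz : ∀ j, j ≠ a → j ≠ b → u j = 0 := fun j h h' => by have := hz j h h'; omega
    have hvz : ∀ j, j ≠ a → j ≠ b → v j = 0 := fun j h h' => by have := hz j h h'; omega
    have := hzero u hu0 huz
    have := hzero v hv0 hvz
    have := hone u hu huz
    have := hone v hv hvz
    omega

theorem smul_eN_injective {n : ℕ} (hr : 0 < rA n) :
    Function.Injective fun i : Fin n => (rA n / Nat.gcd (rA n) (i.val + 1)) • eN i := by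
  intro i j h
  by_contra hij
  have := congrFun h i
  simp only [smul_eN_apply_self, smul_eN_apply_of_ne _ hij] at this
  exact (Nat.div_gcd_pos_of_pos_left _ hr).ne' this

theorem smul_eN_ne_eN_add_eN {n : ℕ} (c : ℕ) (i : Fin n) {a b : Fin n} (hab : a ≠ b) :
    c • eN i ≠ eN a + eN b := by
  intro h
  by_cases hi : a = i
  · have := congrFun h b
    rw [smul_eN_apply_of_ne _ (hi ▸ hab.symm)] at this
    simp [eN] at this
  · have := congrFun h a
    rw [smul_eN_apply_of_ne _ hi] at this
    simp [eN, hab] at this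

theorem finite_isIrredIn_MrA {n : ℕ} (hr : 0 < rA n) :
    {t : Fin n → ℕ | IsIrredIn (MrA n) t}.Finite := by
  refine (Set.finite_Iic (fun _ : Fin n => rA n)).subset ?_
  rintro t ⟨ht, -, hirr⟩ i
  by_contra! hlt
  have hle : rA n • eN i ≤ t := by
    intro j
    by_cases hj : j = i
    · rw [hj, smul_eN_apply_self]; exact hlt.le
    · rw [smul_eN_apply_of_ne _ hj]; exact Nat.zero_le _
  obtain ⟨v, rfl⟩ := exists_add_of_le hle
  have hmem : rA n • eN i ∈ MrA n :=
    (smul_eN_mem_MrA hr _ i).2 (Nat.div_dvd_of_dvd (Nat.gcd_dvd_left _ _))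
  rw [Pi.add_apply, smul_eN_apply_self] at hlt
  refine hirr ⟨rA n • eN i, v, hmem, ?_, fun h => ?_, fun h => ?_, rfl⟩
  · simp only [MrA, Set.mem_ofPred_eq, Pi.add_apply, mul_add, Finset.sum_add_distrib] at ht hmem ⊢
    exact (Nat.dvd_add_right hmem).1 ht
  · have := congrFun h i
    rw [smul_eN_apply_self] at this
    exact hr.ne' this
  · simp [h] at hlt

/-- For type `A_n` with `n ≥ 2`: each `r_k·e_k` (`r_k = r/gcd(r,k)`, `1 ≤ k ≤ n`, 1-based)
and `e_1 + e_n` is an irreducible element of `M_r`, these `n+1` elements are pairwise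
distinct, and hence `M_r` has at least `n+1` irreducible elements. -/
theorem typeA_psi_min_ge (n : ℕ) (hn : 2 ≤ n) :
    (∀ i : Fin n, IsIrredIn (MrA n) ((rA n / Nat.gcd (rA n) (i.val + 1)) • eN i)) ∧
    IsIrredIn (MrA n) (eN ⟨0, by omega⟩ + eN ⟨n - 1, by omega⟩) ∧
    (∀ i j : Fin n,
      (rA n / Nat.gcd (rA n) (i.val + 1)) • eN i =
        (rA n / Nat.gcd (rA n) (j.val + 1)) • eN j → i = j) ∧
    (∀ i : Fin n,
      (rA n / Nat.gcd (rA n) (i.val + 1)) • eN i ≠ eN ⟨0, by omega⟩ + eN ⟨n - 1, by omega⟩) ∧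
    n + 1 ≤ {t : Fin n → ℕ | IsIrredIn (MrA n) t}.ncard := by
  have hr : 0 < rA n := by have := two_le_rA hn; omega
  have hne : (⟨0, by omega⟩ : Fin n) ≠ ⟨n - 1, by omega⟩ := by simp; omega
  have hirr := isIrredIn_eN_zero_add_eN_last hn (by omega) (by omega)
  have hdist := fun i : Fin n =>
    smul_eN_ne_eN_add_eN (rA n / Nat.gcd (rA n) (i.val + 1)) i hne
  refine ⟨isIrredIn_smul_eN hr, hirr, fun i j h => smul_eN_injective hr h, hdist, ?_⟩
  have hnot : eN ⟨0, by omega⟩ + eN ⟨n - 1, by omega⟩ ∉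
      Set.range fun i : Fin n => (rA n / Nat.gcd (rA n) (i.val + 1)) • eN i := by
    rintro ⟨i, hi⟩
    exact hdist i hi
  have hcard := Set.ncard_insert_of_notMem hnot (Set.finite_range _)
  rw [Set.ncard_range_of_injective (smul_eN_injective hr), Nat.card_fin] at hcard
  rw [← hcard]
  refine Set.ncard_le_ncard (Set.insert_subset hirr ?_) (finite_isIrredIn_MrA hr)
  rintro _ ⟨i, rfl⟩
  exact isIrredIn_smul_eN hr i
end

section
/- Let n ≥ 2, let A be the Cartan matrix of type A_n, and let r = (n+1)/gcd(n+1, 2). For every t ∈ ℤ^n, there exists a ∈ ℤ^n with 2t = A·a if and only if r divides Σ_{i=1}^n i·t_i. (Equivalently, a weight λ = Σ t_i λ_i of type A_n lies in Q/2, half the root lattice, if and only if r divides Σ i·t_i.) -/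
/-- `A_n` acts as the negative discrete Laplacian with zero boundary values. -/
lemma cartanA_mulVec_apply (n : ℕ) (b : ℕ → ℤ) (h0 : b 0 = 0) (hn : b (n + 1) = 0) (i : Fin n) :
    (cartanA n).mulVec (fun j => b (j.val + 1)) i = 2 * b (i.val + 1) - b i.val - b (i.val + 2) := by
  obtain ⟨i, hi⟩ := i
  have entry : ∀ j : Fin n, cartanA n ⟨i, hi⟩ j * b (j.val + 1) =
      (if i = j.val then 2 * b (j.val + 1) else 0) - (if i = j.val + 1 then b (j.val + 1) else 0)
        - (if i + 1 = j.val then b (j.val + 1) else 0) := by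
    intro j
    simp only [cartanA, Fin.ext_iff]
    split_ifs <;> omega
  have lower : ∑ j ∈ Finset.range n, (if i = j + 1 then b (j + 1) else 0) = b i := by
    cases i with
    | zero => simp [h0]
    | succ k => simp [Nat.lt_of_succ_lt hi]
  have upper : ∑ j ∈ Finset.range n, (if i + 1 = j then b (j + 1) else 0) = b (i + 2) := by
    rw [Finset.sum_ite_eq]
    split_ifs with h
    · rfl
    · rw [Finset.mem_range] at h
      rw [show i + 2 = n + 1 by omega, hn]
  simp only [Matrix.mulVec, dotProduct, entry]
  rw [Fin.sum_univ_eq_sum_range (fun j => (if i = j then 2 * b (j + 1) else 0)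
    - (if i = j + 1 then b (j + 1) else 0) - (if i + 1 = j then b (j + 1) else 0)) n,
    Finset.sum_sub_distrib, Finset.sum_sub_distrib, lower, upper, Finset.sum_ite_eq,
    if_pos (Finset.mem_range.mpr hi)]

lemma sum_mul_second_difference (b : ℕ → ℤ) (m : ℕ) :
    ∑ j ∈ Finset.range m, ((j : ℤ) + 1) * (2 * b (j + 1) - b j - b (j + 2)) =
      (m + 1) * b m - m * b (m + 1) - b 0 := by
  induction m with
  | zero => simp
  | succ m ih =>
    rw [Finset.sum_range_succ, ih]
    push_cast
    ring

/-- A weight of type `A_n` lies in the root lattice iff `n + 1` divides `∑ i * s_i`. -/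
lemma exists_cartanA_mulVec_eq_iff (n : ℕ) (s : Fin n → ℤ) :
    (∃ a : Fin n → ℤ, (cartanA n).mulVec a = s) ↔
      ((n : ℤ) + 1) ∣ ∑ i, ((i.val : ℤ) + 1) * s i := by
  constructor
  · rintro ⟨a, rfl⟩
    let b : ℕ → ℤ := fun m => if h : 1 ≤ m ∧ m ≤ n then a ⟨m - 1, by omega⟩ else 0
    have h0 : b 0 = 0 := by simp [b]
    have hn : b (n + 1) = 0 := by simp [b]
    have ha : a = fun j : Fin n => b (j.val + 1) := by
      funext j
      have hj : j.val + 1 ≤ n := j.isLt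
      simp [b, hj]
    rw [ha]
    simp only [cartanA_mulVec_apply n b h0 hn]
    rw [Fin.sum_univ_eq_sum_range
      (fun j => ((j : ℤ) + 1) * (2 * b (j + 1) - b j - b (j + 2))) n,
      sum_mul_second_difference, h0, hn]
    exact ⟨b n, by ring⟩
  · rintro ⟨c, hc⟩
    let s' : ℕ → ℤ := fun m => if h : m < n then s ⟨m, h⟩ else 0
    have hs : ∀ i : Fin n, s i = s' i.val := fun i => by simp [s']
    let u : ℕ → ℤ := fun m => ∑ j ∈ Finset.range n, s' j - c - ∑ j ∈ Finset.range m, s' j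
    let b : ℕ → ℤ := fun m => ∑ k ∈ Finset.range m, u k
    have hb : ∀ m, b (m + 1) = b m + u m := fun m => Finset.sum_range_succ u m
    have hu : ∀ m, u (m + 1) = u m - s' m := fun m => by
      simp only [u, Finset.sum_range_succ]
      ring
    have hrec : ∀ m, 2 * b (m + 1) - b m - b (m + 2) = s' m := fun m => by
      rw [hb (m + 1), hb m, hu m]
      ring
    have h0 : b 0 = 0 := rfl
    have hn : b (n + 1) = 0 := by
      have key := sum_mul_second_difference b n
      simp only [hrec] at key
      simp only [hs] at hc
      rw [Fin.sum_univ_eq_sum_range (fun j => ((j : ℤ) + 1) * s' j) n, key, h0] at hc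
      have hun : u n = -c := by simp only [u]; ring
      have hbn := hb n
      rw [hun] at hbn
      linear_combination hc + ((n : ℤ) + 1) * hbn
    refine ⟨fun j => b (j.val + 1), funext fun i => ?_⟩
    rw [cartanA_mulVec_apply n b h0 hn, hrec, hs]

lemma rA_dvd_iff (n : ℕ) (x : ℤ) : (rA n : ℤ) ∣ x ↔ ((n : ℤ) + 1) ∣ 2 * x := by
  rw [← Nat.cast_succ, Nat.succ_eq_add_one, rA]
  rcases Nat.even_or_odd' (n + 1) with ⟨k, hk | hk⟩
  · rw [hk, Nat.gcd_mul_right_left, Nat.mul_div_cancel_left _ two_pos, Nat.cast_mul,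
      Nat.cast_ofNat, mul_dvd_mul_iff_left two_ne_zero]
  · have h : Nat.Coprime (n + 1) 2 := Nat.coprime_two_right.mpr ⟨k, hk⟩
    rw [h.gcd_eq_one, Nat.div_one]
    exact ⟨fun hx => hx.mul_left 2,
      (Nat.isCoprime_iff_coprime.mpr h).dvd_of_dvd_mul_left⟩

/-- For type `A_n` with `n ≥ 2`: a weight `t ∈ ℤ^n` (fundamental-weight coordinates)
satisfies `2t ∈ A·ℤ^n` (i.e. `λ ∈ Q/2`) if and only if `r ∣ Σ i·t_i` (1-based `i`). -/
theorem typeA_halfQ_criterion (n : ℕ) (hn : 2 ≤ n) (t : Fin n → ℤ) :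
    (∃ a : Fin n → ℤ, (cartanA n).mulVec a = 2 • t) ↔
      (rA n : ℤ) ∣ ∑ i, ((i.val : ℤ) + 1) * t i := by
  rw [exists_cartanA_mulVec_eq_iff, rA_dvd_iff, Finset.mul_sum]
  simp only [Pi.smul_apply, nsmul_eq_mul, Nat.cast_ofNat, mul_left_comm]
end

section
/- Let n ≥ 2, r = (n+1)/gcd(n+1, 2), and M_r = {t ∈ ℕ^n : r divides Σ_{i=1}^n i·t_i}. For an integer k with 2 ≤ k ≤ n and k ≠ r, define d_k = r − k if k < r and d_k = 2r − k if k > r. Then the vector e(k) := d_k·e_1 + e_k belongs to M_r and is an irreducible element of M_r; moreover d_k is the least positive integer d such that d·e_1 + e_k ∈ M_r. -/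
/-- `d_k = r - k` if `k < r`, and `d_k = 2r - k` if `k > r` (for `k ≠ r`). -/
def dkA (n k : ℕ) : ℕ := if k < rA n then rA n - k else 2 * rA n - k

theorem lt_two_mul_rA (n : ℕ) : n < 2 * rA n := by
  have hg : Nat.gcd (n + 1) 2 ∣ n + 1 := Nat.gcd_dvd_left _ _
  have hle : Nat.gcd (n + 1) 2 ≤ 2 := Nat.gcd_le_right _ two_pos
  have h := Nat.mul_div_cancel' hg
  change _ * rA n = _ at h
  have := Nat.mul_le_mul_right (rA n) hle
  omega

theorem sum_weight_smul_eN {n : ℕ} (d : ℕ) (i : Fin n) :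
    ∑ j, (j.val + 1) * (d • eN i) j = (i.val + 1) * d := by
  rw [Finset.sum_eq_single i]
  · simp [eN]
  · intro j _ hj
    simp [eN, hj]
  · simp

theorem smul_eN_add_eN_mem_MrA {n : ℕ} (d : ℕ) (i j : Fin n) :
    d • eN i + eN j ∈ MrA n ↔ rA n ∣ (i.val + 1) * d + (j.val + 1) := by
  have hj := sum_weight_smul_eN 1 j
  rw [one_smul, mul_one] at hj
  simp only [MrA, Set.mem_ofPred_eq, Pi.add_apply, mul_add, Finset.sum_add_distrib]
  rw [sum_weight_smul_eN, hj]

/-- An element of `M_r` dominated by `d • e_1` with `d < r` vanishes. -/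
theorem eq_zero_of_mem_MrA {n d : ℕ} (i : Fin n) (hi : i.val = 0) (hd : d < rA n)
    {u : Fin n → ℕ} (hu : u ∈ MrA n) (hle : ∀ j, u j ≤ (d • eN i) j) : u = 0 := by
  have hui : u = u i • eN i := by
    funext j
    by_cases hj : j = i
    · simp [hj, eN]
    · simpa [eN, hj] using hle j
  have hui_le : u i ≤ d := by simpa [eN] using hle i
  have hdvd : rA n ∣ u i := by
    have h : rA n ∣ ∑ j, (j.val + 1) * u j := hu
    rw [hui, sum_weight_smul_eN, hi] at h
    simpa using h
  rw [hui, Nat.eq_zero_of_dvd_of_lt hdvd (by omega), zero_smul]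

/-- If `d < r`, then `d • e_1 + e_j` is irreducible in `M_r` as soon as it lies in `M_r`. -/
theorem isIrredIn_smul_eN_add_eN {n d : ℕ} (i j : Fin n) (hi : i.val = 0)
    (hd : d < rA n) (hmem : d • eN i + eN j ∈ MrA n) :
    IsIrredIn (MrA n) (d • eN i + eN j) := by
  have key : ∀ u v : Fin n → ℕ, u ∈ MrA n → d • eN i + eN j = u + v → 1 ≤ v j → u = 0 := by
    intro u v hu huv hvj
    refine eq_zero_of_mem_MrA i hi hd hu fun l => ?_
    have hl := congrFun huv l
    by_cases hlj : l = j
    · subst hlj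
      simp only [Pi.add_apply, eN, Pi.single_eq_same] at hl ⊢
      omega
    · simp only [Pi.add_apply, eN, Pi.single_eq_of_ne hlj] at hl ⊢
      omega
  refine ⟨hmem, fun h => ?_, ?_⟩
  · simpa [eN] using congrFun h j
  · rintro ⟨u, v, hu, hv, hu0, hv0, huv⟩
    have hj := congrFun huv j
    simp only [Pi.add_apply, eN, Pi.single_eq_same] at hj
    rcases Nat.eq_zero_or_pos (v j) with hvj | hvj
    · exact hv0 (key v u hv (by rw [huv, add_comm]) (by omega))
    · exact hu0 (key u v hu huv hvj)

/-- For `2 ≤ k ≤ n`, `k ≠ r`: `e(k) = d_k·e_1 + e_k` belongs to `M_r` and is irreducible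
in `M_r`; moreover `d_k` is the least positive integer `d` with `d·e_1 + e_k ∈ M_r`. -/
theorem typeA_special_irreducible (n : ℕ) (hn : 2 ≤ n) (k : ℕ)
    (hk2 : 2 ≤ k) (hkn : k ≤ n) (hkr : k ≠ rA n) :
    (dkA n k • eN ⟨0, by omega⟩ + eN ⟨k - 1, by omega⟩) ∈ MrA n ∧
    IsIrredIn (MrA n) (dkA n k • eN ⟨0, by omega⟩ + eN ⟨k - 1, by omega⟩) ∧
    0 < dkA n k ∧
    (∀ d : ℕ, 0 < d → (d • eN ⟨0, by omega⟩ + eN ⟨k - 1, by omega⟩) ∈ MrA n →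
      dkA n k ≤ d) := by
  have hr := lt_two_mul_rA n
  have hd : dkA n k < rA n ∧ 0 < dkA n k ∧ (dkA n k + k = rA n ∨ dkA n k + k = 2 * rA n) := by
    unfold dkA
    split_ifs <;> omega
  obtain ⟨hdr, hd0, hdk⟩ := hd
  have hdvd : rA n ∣ dkA n k + k := by
    rcases hdk with h | h <;> rw [h]
    exact Dvd.intro_left 2 rfl
  have hiff : ∀ d : ℕ, d • eN (⟨0, by omega⟩ : Fin n) + eN ⟨k - 1, by omega⟩ ∈ MrA n ↔
      rA n ∣ d + k := by
    intro d
    rw [smul_eN_add_eN_mem_MrA, zero_add, one_mul, Nat.sub_add_cancel (by omega)]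
  have hmem := (hiff _).2 hdvd
  refine ⟨hmem, isIrredIn_smul_eN_add_eN _ _ rfl hdr hmem, hd0, fun d hpos hdmem => ?_⟩
  by_contra! hlt
  have hsub := Nat.dvd_sub hdvd ((hiff d).1 hdmem)
  have := Nat.le_of_dvd (by omega) hsub
  omega
end

section
/- Let F be a field and n ≥ 3 an integer. Let R be the F-subalgebra of the polynomial ring F[z_1, …, z_n] spanned by all monomials z_1^{t_1}⋯z_n^{t_n} with t_{n−1} + t_n even; equivalently, R is the F-subalgebra generated by z_1, …, z_{n−2}, z_{n−1}^2, z_n^2 and z_{n−1}z_n. Then the F-algebra homomorphism F[t_1, …, t_{n+1}] → R sending t_i ↦ z_i for 1 ≤ i ≤ n−2, t_{n−1} ↦ z_{n−1}^2, t_n ↦ z_n^2, t_{n+1} ↦ z_{n−1}z_n is surjective with kernel the ideal generated by t_{n−1}t_n − t_{n+1}^2, so it induces an F-algebra isomorphism F[t_1, …, t_{n+1}]/(t_{n−1}t_n − t_{n+1}^2) ≅ R. (For n odd this R is the monoid algebra F[Ψ] of type D_n, hence the center Z(U_q(g)) for g of type D_n with n odd is isomorphic to F[t_1,…,t_{n+1}]/(t_{n−1}t_n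 − t_{n+1}^2) with F = ℂ(q).) -/
namespace TypeD

open MvPolynomial

variable {n : ℕ}

lemma val_lt_of_add_two_lt {i : Fin (n + 1)} (h : i.val + 2 < n) : i.val < n := by omega

/-- The exponent vector of the image of the monomial with exponent vector `e` under the map
`t_i ↦ z_i`, `t_{n-1} ↦ z_{n-1}²`, `t_n ↦ z_n²`, `t_{n+1} ↦ z_{n-1}z_n`. -/
noncomputable def expMap (hn : 2 ≤ n) (e : Fin (n + 1) →₀ ℕ) : Fin n →₀ ℕ :=
  Finsupp.equivFunOnFinite.symm fun j =>
    if j.val + 2 < n then e j.castSucc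
    else if j.val + 2 = n then 2 * e ⟨n - 2, by omega⟩ + e (Fin.last n)
    else 2 * e ⟨n - 1, by omega⟩ + e (Fin.last n)

/-- The preimage under `expMap` whose last exponent is at most one (provided that the last two
exponents of `t` have even sum). -/
noncomputable def expSection (hn : 2 ≤ n) (t : Fin n →₀ ℕ) : Fin (n + 1) →₀ ℕ :=
  Finsupp.equivFunOnFinite.symm fun i =>
    if h : i.val + 2 < n then t ⟨i.val, val_lt_of_add_two_lt h⟩
    else if i.val + 2 = n then t ⟨n - 2, by omega⟩ / 2
    else if i.val + 1 = n then t ⟨n - 1, by omega⟩ / 2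
    else t ⟨n - 2, by omega⟩ % 2

lemma expMap_apply (hn : 2 ≤ n) (e : Fin (n + 1) →₀ ℕ) (j : Fin n) :
    expMap hn e j = if j.val + 2 < n then e j.castSucc
      else if j.val + 2 = n then 2 * e ⟨n - 2, by omega⟩ + e (Fin.last n)
      else 2 * e ⟨n - 1, by omega⟩ + e (Fin.last n) := rfl

lemma expSection_apply (hn : 2 ≤ n) (t : Fin n →₀ ℕ) (i : Fin (n + 1)) :
    expSection hn t i = if h : i.val + 2 < n then t ⟨i.val, val_lt_of_add_two_lt h⟩
      else if i.val + 2 = n then t ⟨n - 2, by omega⟩ / 2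
      else if i.val + 1 = n then t ⟨n - 1, by omega⟩ / 2
      else t ⟨n - 2, by omega⟩ % 2 := rfl

lemma expMap_zero (hn : 2 ≤ n) : expMap hn 0 = 0 := by
  ext j
  simp [expMap_apply]

lemma expMap_add (hn : 2 ≤ n) (d e : Fin (n + 1) →₀ ℕ) :
    expMap hn (d + e) = expMap hn d + expMap hn e := by
  ext j
  simp only [expMap_apply, Finsupp.add_apply]
  split_ifs <;> ring

lemma expMap_even (hn : 2 ≤ n) (e : Fin (n + 1) →₀ ℕ) :
    Even (expMap hn e ⟨n - 2, by omega⟩ + expMap hn e ⟨n - 1, by omega⟩) := by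
  have h₁ : expMap hn e ⟨n - 2, by omega⟩ = 2 * e ⟨n - 2, by omega⟩ + e (Fin.last n) := by
    rw [expMap_apply, if_neg (by simp; omega), if_pos (by simp; omega)]
  have h₂ : expMap hn e ⟨n - 1, by omega⟩ = 2 * e ⟨n - 1, by omega⟩ + e (Fin.last n) := by
    rw [expMap_apply, if_neg (by simp; omega), if_neg (by simp; omega)]
  rw [h₁, h₂]
  exact ⟨e ⟨n - 2, by omega⟩ + e ⟨n - 1, by omega⟩ + e (Fin.last n), by ring⟩

lemma expMap_expSection (hn : 2 ≤ n) {t : Fin n →₀ ℕ}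
    (ht : Even (t ⟨n - 2, by omega⟩ + t ⟨n - 1, by omega⟩)) :
    expMap hn (expSection hn t) = t := by
  ext j
  rw [Nat.even_iff] at ht
  rw [expMap_apply]
  split_ifs with h₁ h₂
  · rw [expSection_apply, dif_pos (by simpa using h₁)]
    rfl
  · have hj : j = ⟨n - 2, by omega⟩ := Fin.ext (by simp; omega)
    rw [hj]
    simp only [expSection_apply, Fin.val_last]
    grind
  · have hj : j = ⟨n - 1, by omega⟩ := Fin.ext (by simp; omega)
    rw [hj]
    simp only [expSection_apply, Fin.val_last]
    grind

/-- Normalising the exponent vector `e` replaces `2 * (e_{n+1} / 2)` of the last exponent by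
`e_{n+1} / 2` in each of the two preceding ones. -/
lemma exists_eq_add_single (hn : 2 ≤ n) (e : Fin (n + 1) →₀ ℕ) :
    ∃ (d : Fin (n + 1) →₀ ℕ) (k : ℕ), e = d + k • Finsupp.single (Fin.last n) 2 ∧
      expSection hn (expMap hn e) = d + k • (Finsupp.single ⟨n - 2, by omega⟩ 1 +
        Finsupp.single ⟨n - 1, by omega⟩ 1) := by
  refine ⟨e.update (Fin.last n) (e (Fin.last n) % 2), e (Fin.last n) / 2, ?_, ?_⟩
  · ext i
    by_cases hi : i = Fin.last n
    · subst hi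
      simp
      omega
    · simp [hi]
  · ext i
    have h : i.val + 2 < n ∨ i = ⟨n - 2, by omega⟩ ∨ i = ⟨n - 1, by omega⟩ ∨ i = Fin.last n := by
      simp only [Fin.ext_iff, Fin.val_last]
      omega
    simp only [expSection_apply, expMap_apply, Finsupp.add_apply, Finsupp.smul_apply,
      Finsupp.single_apply, Finsupp.update_apply, Fin.ext_iff, Fin.val_last, smul_eq_mul]
    rcases h with h | rfl | rfl | rfl
    · have : (⟨i.val, val_lt_of_add_two_lt h⟩ : Fin n).castSucc = i := rfl
      grind
    · grind
    · grind
    · simp only [Fin.val_last]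
      grind

section Presentation

variable {F : Type*} [Field F]

lemma prod_X_pow (t : Fin n →₀ ℕ) :
    ∏ i, (X i : MvPolynomial (Fin n) F) ^ t i = monomial t 1 := by
  rw [monomial_eq, C_1, one_mul, Finsupp.prod_fintype _ _ fun _ => pow_zero _]

/-- The map `t_i ↦ z_i`, `t_{n-1} ↦ z_{n-1}²`, `t_n ↦ z_n²`, `t_{n+1} ↦ z_{n-1}z_n`. -/
noncomputable def presentation (F : Type*) [Field F] (hn : 2 ≤ n) :
    MvPolynomial (Fin (n + 1)) F →ₐ[F] MvPolynomial (Fin n) F :=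
  aeval fun i : Fin (n + 1) =>
    if h : i.val + 2 < n then X (⟨i.val, val_lt_of_add_two_lt h⟩ : Fin n)
    else if i.val + 2 = n then X (⟨n - 2, by omega⟩ : Fin n) ^ 2
    else if i.val + 1 = n then X (⟨n - 1, by omega⟩ : Fin n) ^ 2
    else X (⟨n - 2, by omega⟩ : Fin n) * X (⟨n - 1, by omega⟩ : Fin n)

lemma presentation_X (hn : 2 ≤ n) (i : Fin (n + 1)) :
    presentation F hn (X i) = monomial (expMap hn (Finsupp.single i 1)) 1 := by
  rw [presentation, aeval_X]
  split_ifs with h₁ h₂ h₃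
  · rw [X]
    congr 2
    ext j
    simp only [expMap_apply, Finsupp.single_apply, Fin.ext_iff, Fin.val_last, Fin.val_castSucc]
    grind
  · rw [X_pow_eq_monomial]
    congr 2
    ext j
    simp only [expMap_apply, Finsupp.single_apply, Fin.ext_iff, Fin.val_last, Fin.val_castSucc]
    grind
  · rw [X_pow_eq_monomial]
    congr 2
    ext j
    simp only [expMap_apply, Finsupp.single_apply, Fin.ext_iff, Fin.val_last, Fin.val_castSucc]
    grind
  · rw [X, X, monomial_mul, one_mul]
    congr 2
    ext j
    simp only [expMap_apply, Finsupp.single_apply, Finsupp.add_apply, Fin.ext_iff, Fin.val_last,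
      Fin.val_castSucc]
    grind

lemma presentation_monomial_one (hn : 2 ≤ n) (e : Fin (n + 1) →₀ ℕ) :
    presentation F hn (monomial e 1) = monomial (expMap hn e) 1 := by
  induction e using Finsupp.induction_linear with
  | zero => rw [expMap_zero]; exact map_one _
  | add d e hd he =>
    rw [expMap_add, ← one_mul (1 : F), ← monomial_mul, ← monomial_mul, map_mul, hd, he]
  | single i k =>
    induction k with
    | zero => rw [Finsupp.single_zero, expMap_zero]; exact map_one _
    | succ k ih =>
      rw [Finsupp.single_add, expMap_add, ← one_mul (1 : F), ← monomial_mul, ← monomial_mul,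
        map_mul, ih, ← presentation_X, X]

lemma presentation_monomial (hn : 2 ≤ n) (e : Fin (n + 1) →₀ ℕ) (c : F) :
    presentation F hn (monomial e c) = c • monomial (expMap hn e) 1 := by
  rw [← presentation_monomial_one, ← map_smul, smul_monomial, smul_eq_mul, mul_one]

lemma range_presentation (hn : 2 ≤ n) :
    ((presentation F hn).range : Set (MvPolynomial (Fin n) F)) =
      Submodule.span F {p : MvPolynomial (Fin n) F | ∃ t : Fin n → ℕ,
        Even (t ⟨n - 2, by omega⟩ + t ⟨n - 1, by omega⟩) ∧ p = ∏ i, X i ^ t i} := by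
  apply Set.Subset.antisymm
  · rintro _ ⟨p, rfl⟩
    induction p using MvPolynomial.induction_on' with
    | monomial e c =>
      change presentation F hn (monomial e c) ∈ Submodule.span F _
      rw [presentation_monomial]
      exact Submodule.smul_mem _ _ (Submodule.subset_span
        ⟨expMap hn e, expMap_even hn e, (prod_X_pow _).symm⟩)
    | add p q hp hq =>
      change presentation F hn (p + q) ∈ Submodule.span F _
      rw [map_add]
      exact Submodule.add_mem _ hp hq
  · change Submodule.span F _ ≤ Subalgebra.toSubmodule (presentation F hn).range
    rw [Submodule.span_le]
    rintro _ ⟨t, ht, rfl⟩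
    refine ⟨monomial (expSection hn (Finsupp.equivFunOnFinite.symm t)) 1, ?_⟩
    change presentation F hn _ = _
    rw [presentation_monomial_one, expMap_expSection hn (by simpa using ht), ← prod_X_pow]
    rfl

/-- The ideal `(t_{n-1}t_n - t_{n+1}²)`. -/
noncomputable def relationIdeal (F : Type*) [Field F] (hn : 2 ≤ n) :
    Ideal (MvPolynomial (Fin (n + 1)) F) :=
  Ideal.span {X (⟨n - 2, by omega⟩ : Fin (n + 1)) * X (⟨n - 1, by omega⟩ : Fin (n + 1))
    - X (Fin.last n) ^ 2}

lemma monomial_sub_monomial_mem (hn : 2 ≤ n) (e : Fin (n + 1) →₀ ℕ) :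
    monomial e 1 - monomial (expSection hn (expMap hn e)) 1 ∈ relationIdeal F hn := by
  obtain ⟨d, k, h₁, h₂⟩ := exists_eq_add_single hn e
  have hk : ∀ u : Fin (n + 1) →₀ ℕ,
      (monomial (d + k • u) 1 : MvPolynomial (Fin (n + 1)) F) =
        monomial d 1 * monomial u 1 ^ k := fun u => by
    rw [monomial_pow, one_pow, monomial_mul, one_mul]
  have hgen : (monomial (Finsupp.single ⟨n - 2, by omega⟩ 1 + Finsupp.single ⟨n - 1, by omega⟩ 1) 1
      - monomial (Finsupp.single (Fin.last n) 2) 1 : MvPolynomial (Fin (n + 1)) F) ∈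
        relationIdeal F hn := by
    rw [← X_pow_eq_monomial, ← one_mul (1 : F), ← monomial_mul]
    exact Ideal.subset_span rfl
  rw [h₂, hk]
  conv in monomial e 1 => rw [h₁, hk]
  rw [← mul_sub, ← neg_sub, mul_neg]
  exact neg_mem (Ideal.mul_mem_left _ _
    (Ideal.mem_of_dvd _ (sub_dvd_pow_sub_pow _ _ k) hgen))

/-- The linear map taking each monomial `z^t` to the monomial with exponents `expSection t`. -/
noncomputable def linearSection (F : Type*) [Field F] (hn : 2 ≤ n) :
    MvPolynomial (Fin n) F →ₗ[F] MvPolynomial (Fin (n + 1)) F :=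
  (basisMonomials (Fin n) F).constr F fun t => monomial (expSection hn t) 1

lemma linearSection_monomial (hn : 2 ≤ n) (t : Fin n →₀ ℕ) :
    linearSection F hn (monomial t 1) = monomial (expSection hn t) 1 := by
  rw [linearSection, ← congrFun (coe_basisMonomials (Fin n) F) t, Module.Basis.constr_basis]

lemma sub_linearSection_mem (hn : 2 ≤ n) (p : MvPolynomial (Fin (n + 1)) F) :
    p - linearSection F hn (presentation F hn p) ∈ relationIdeal F hn := by
  induction p using MvPolynomial.induction_on' with
  | monomial e c =>
    rw [presentation_monomial, map_smul, linearSection_monomial, ← mul_one c, ← smul_eq_mul,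
      ← smul_monomial, smul_eq_mul, mul_one, ← smul_sub, smul_eq_C_mul]
    exact Ideal.mul_mem_left _ _ (monomial_sub_monomial_mem hn e)
  | add p q hp hq =>
    rw [map_add, map_add, add_sub_add_comm]
    exact add_mem hp hq

lemma ker_presentation (hn : 2 ≤ n) :
    RingHom.ker (presentation F hn).toRingHom = relationIdeal F hn := by
  apply le_antisymm
  · intro p hp
    have hp' : presentation F hn p = 0 := hp
    simpa [hp'] using sub_linearSection_mem hn p
  · rw [relationIdeal, Ideal.span_singleton_le_iff_mem]
    change presentation F hn _ = 0
    simp only [presentation, map_sub, map_mul, map_pow, aeval_X, Fin.val_last]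
    rw [dif_neg (by omega), if_pos (by omega), dif_neg (by omega), if_neg (by omega),
      if_pos (by omega), dif_neg (by omega), if_neg (by omega), if_neg (by omega)]
    ring

end Presentation

end TypeD


open MvPolynomial in
/-- Let `F` be a field and `n ≥ 3`. The `F`-algebra map
`F[t_1,…,t_{n+1}] → F[z_1,…,z_n]`, `t_i ↦ z_i (i ≤ n-2)`, `t_{n-1} ↦ z_{n-1}²`,
`t_n ↦ z_n²`, `t_{n+1} ↦ z_{n-1}z_n`, has image the `F`-span `R` of the monomials
`z^t` with `t_{n-1} + t_n` even, and kernel the ideal `(t_{n-1}t_n - t_{n+1}²)`;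
hence `F[t_1,…,t_{n+1}]/(t_{n-1}t_n - t_{n+1}²) ≅ R`.  (For `n` odd, `R ≅ F[Ψ]` of
type `D_n`, so this computes `Z(U_q(g))` for `g` of type `D_n`, `n` odd, `F = ℂ(q)`.) -/
theorem typeD_center_presentation (F : Type*) [Field F] (n : ℕ) (hn : 3 ≤ n) :
    ∀ φ : MvPolynomial (Fin (n + 1)) F →ₐ[F] MvPolynomial (Fin n) F,
      φ = aeval (fun i : Fin (n + 1) =>
        if h : i.val + 2 < n then X (⟨i.val, by omega⟩ : Fin n)
        else if i.val + 2 = n then X (⟨n - 2, by omega⟩ : Fin n) ^ 2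
        else if i.val + 1 = n then X (⟨n - 1, by omega⟩ : Fin n) ^ 2
        else X (⟨n - 2, by omega⟩ : Fin n) * X (⟨n - 1, by omega⟩ : Fin n)) →
      (φ.range : Set (MvPolynomial (Fin n) F)) =
        ↑(Submodule.span F {p : MvPolynomial (Fin n) F | ∃ t : Fin n → ℕ,
            Even (t ⟨n - 2, by omega⟩ + t ⟨n - 1, by omega⟩) ∧ p = ∏ i, X i ^ t i}) ∧
      RingHom.ker φ.toRingHom =
        Ideal.span {X (⟨n - 2, by omega⟩ : Fin (n + 1)) * X (⟨n - 1, by omega⟩ : Fin (n + 1))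
          - X (⟨n, by omega⟩ : Fin (n + 1)) ^ 2} := by
  rintro φ rfl
  have hn' : 2 ≤ n := by omega
  exact ⟨TypeD.range_presentation hn', TypeD.ker_presentation hn'⟩
end
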